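/- arXiv:math/0306089 — 4 statements merged into one kernel-verified Lean document; each statement's English description precedes it below -/
import Mathlib

section
/- Let (Y,d) be a metric space, let μ be a finite Borel measure on Y, let F > 0 and let k ≥ 1 be an integer. For y ∈ Y define r₀(y) := sup{r ≥ 0 : μ(B(y,r)) ≥ F·r^k}, where B(y,r) denotes the closed ball of radius r centered at y. There exists a constant α > 0 depending only on k such that: if r₀(y) > 0 for μ-almost every y ∈ Y, then there exist finitely many points y₁, …, y_N ∈ Y such that (i) r₀(y_i) > 0 for each i, (ii) the closed balls B(y_i, 2·r₀(y_i)) are pairwise disjoint, and (iii) Σ_{i=1}^N μ(B(y_i, r₀(y_i))) ≥ α·μ(Y). -/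
open MeasureTheory Metric Set

section DensityRadii

variable {Y : Type*} [MetricSpace Y] [MeasurableSpace Y]

/-- The radii `r ≥ 0` for which `μ (closedBall y r) ≥ F * r ^ k`. -/
def densityRadii (μ : Measure Y) (F : ℝ) (k : ℕ) (y : Y) : Set ℝ :=
  {r : ℝ | 0 ≤ r ∧ ENNReal.ofReal (F * r ^ k) ≤ μ (closedBall y r)}

variable {μ : Measure Y} {F : ℝ} {k : ℕ}

theorem le_of_mem_densityRadii [IsFiniteMeasure μ] (hF : 0 < F) (hk : 1 ≤ k) {y : Y} {r : ℝ}
    (hr : r ∈ densityRadii μ F k y) : r ≤ max 1 (μ.real univ / F) := by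
  rcases le_total r 1 with h1 | h1
  · exact le_max_of_le_left h1
  · refine le_max_of_le_right ((le_div_iff₀ hF).2 ?_)
    have hmass : F * r ^ k ≤ μ.real univ :=
      (ENNReal.ofReal_le_iff_le_toReal (measure_ne_top μ _)).1
        (hr.2.trans (measure_mono (subset_univ _)))
    have hpow : r ≤ r ^ k := le_self_pow₀ h1 (by omega)
    nlinarith

theorem bddAbove_densityRadii [IsFiniteMeasure μ] (hF : 0 < F) (hk : 1 ≤ k) (y : Y) :
    BddAbove (densityRadii μ F k y) :=
  ⟨_, fun _ hr => le_of_mem_densityRadii hF hk hr⟩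

theorem zero_mem_densityRadii (hk : 1 ≤ k) (y : Y) : (0 : ℝ) ∈ densityRadii μ F k y :=
  ⟨le_rfl, by simp [zero_pow (by omega : k ≠ 0)]⟩

theorem sSup_densityRadii_le [IsFiniteMeasure μ] (hF : 0 < F) (hk : 1 ≤ k) (y : Y) :
    sSup (densityRadii μ F k y) ≤ max 1 (μ.real univ / F) :=
  csSup_le ⟨0, zero_mem_densityRadii hk y⟩ fun _ hr => le_of_mem_densityRadii hF hk hr

theorem le_measure_closedBall_sSup_densityRadii [IsFiniteMeasure μ] (hF : 0 < F) (hk : 1 ≤ k)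
    (y : Y) :
    ENNReal.ofReal (F * sSup (densityRadii μ F k y) ^ k) ≤
      μ (closedBall y (sSup (densityRadii μ F k y))) := by
  have hbdd := bddAbove_densityRadii (μ := μ) hF hk y
  have hclosed : IsClosed {s : ℝ | ENNReal.ofReal (F * s ^ k) ≤
      μ (closedBall y (sSup (densityRadii μ F k y)))} :=
    isClosed_le (ENNReal.continuous_ofReal.comp (by fun_prop)) continuous_const
  refine hclosed.closure_subset_iff.2 (fun s hs => ?_)
    (csSup_mem_closure ⟨0, zero_mem_densityRadii hk y⟩ hbdd)
  exact hs.2.trans (measure_mono (closedBall_subset_closedBall (le_csSup hbdd hs)))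

/-- Enlarging the extremal ball by a factor `c > 1` multiplies its measure by at most `c ^ k`. -/
theorem measure_closedBall_mul_sSup_densityRadii_le [IsFiniteMeasure μ] (hF : 0 < F) (hk : 1 ≤ k)
    {y : Y} (hy : 0 < sSup (densityRadii μ F k y)) {c : ℝ} (hc : 1 < c) :
    μ (closedBall y (c * sSup (densityRadii μ F k y))) ≤
      ENNReal.ofReal (c ^ k) * μ (closedBall y (sSup (densityRadii μ F k y))) := by
  set R := sSup (densityRadii μ F k y) with hR
  have hnot : c * R ∉ densityRadii μ F k y := fun hmem => by
    have := le_csSup (bddAbove_densityRadii hF hk y) hmem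
    nlinarith
  have hlt : μ (closedBall y (c * R)) < ENNReal.ofReal (F * (c * R) ^ k) :=
    not_le.1 fun h => hnot ⟨by positivity, h⟩
  calc μ (closedBall y (c * R)) ≤ ENNReal.ofReal (F * (c * R) ^ k) := hlt.le
    _ = ENNReal.ofReal (c ^ k) * ENNReal.ofReal (F * R ^ k) := by
      rw [← ENNReal.ofReal_mul (by positivity)]
      congr 1
      ring
    _ ≤ _ := by
      gcongr
      exact le_measure_closedBall_sSup_densityRadii hF hk y

end DensityRadii

/-- Vitali-type covering lemma (Lemma 3.2 of Wenger, "Isoperimetric inequalities of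
euclidean type in metric spaces"): there is a constant `α > 0`, depending only on `k`,
such that for every metric space `Y`, every finite Borel measure `μ` on `Y`, and every
`F > 0`, if `r₀ y := sup {r ≥ 0 : μ(B(y,r)) ≥ F r^k}` is positive for `μ`-a.e. `y`,
then there exist finitely many points `y₁, …, y_N` with `r₀ yᵢ > 0`, the closed balls
`B(yᵢ, 2 r₀ yᵢ)` pairwise disjoint, and `∑ μ(B(yᵢ, r₀ yᵢ)) ≥ α μ(Y)`. -/
theorem vitali_type_partial_cover (k : ℕ) (hk : 1 ≤ k) :
    ∃ α : ℝ, 0 < α ∧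
      ∀ (Y : Type) [MetricSpace Y] [MeasurableSpace Y] [BorelSpace Y]
        (μ : Measure Y) [IsFiniteMeasure μ] (F : ℝ), 0 < F →
        ∀ r₀ : Y → ℝ,
          (r₀ = fun y => sSup {r : ℝ | 0 ≤ r ∧
              ENNReal.ofReal (F * r ^ k) ≤ μ (closedBall y r)}) →
          (∀ᵐ y ∂μ, 0 < r₀ y) →
          ∃ (N : ℕ) (y : Fin N → Y),
            (∀ i, 0 < r₀ (y i)) ∧
            (Pairwise fun i j =>
              Disjoint (closedBall (y i) (2 * r₀ (y i)))
                (closedBall (y j) (2 * r₀ (y j)))) ∧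
            ENNReal.ofReal α * μ Set.univ ≤
              ∑ i, μ (closedBall (y i) (r₀ (y i))) := by
  refine ⟨(2 * 8 ^ k)⁻¹, by positivity, ?_⟩
  intro Y _ _ _ μ _ F hF r₀ hr₀ hpos
  change r₀ = fun y => sSup (densityRadii μ F k y) at hr₀
  rcases eq_or_ne (μ univ) 0 with h0 | h0
  · exact ⟨0, Fin.elim0, fun i => i.elim0, fun i => i.elim0, by simp [h0]⟩
  obtain ⟨u, hut, hdisj, hcov⟩ := Vitali.exists_disjoint_subfamily_covering_enlargement_closedBall
    {y | 0 < r₀ y} id (fun y => 2 * r₀ y) (2 * max 1 (μ.real univ / F))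
    (fun y _ => by
      have := sSup_densityRadii_le (μ := μ) hF hk y
      simp only [hr₀]
      linarith) 4 (by norm_num)
  simp only [id] at hdisj hcov
  have hball_pos : ∀ y ∈ u, 0 < μ (closedBall y (2 * r₀ y)) := fun y hy => by
    have hy0 : 0 < r₀ y := hut hy
    have hle : ENNReal.ofReal (F * r₀ y ^ k) ≤ μ (closedBall y (r₀ y)) := by
      simpa only [hr₀] using le_measure_closedBall_sSup_densityRadii (μ := μ) hF hk y
    exact (ENNReal.ofReal_pos.2 (by positivity)).trans_le
      (hle.trans (measure_mono (closedBall_subset_closedBall (by linarith))))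
  have hcount : u.Countable := by
    have h := Measure.countable_meas_pos_of_disjoint_iUnion (μ := μ)
      (As := fun y : u => closedBall (y : Y) (2 * r₀ y)) (fun _ => isClosed_closedBall.measurableSet)
      (fun a b hab => hdisj a.2 b.2 (Subtype.coe_injective.ne hab))
    rw [show {y : u | 0 < μ (closedBall (y : Y) (2 * r₀ y))} = univ from
      eq_univ_of_forall fun y => hball_pos y y.2] at h
    exact countable_coe_iff.1 (countable_univ_iff.1 h)
  have htotal : μ univ ≤ ENNReal.ofReal (8 ^ k) * ∑' y : u, μ (closedBall (y : Y) (r₀ y)) := by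
    calc μ univ = μ {y | 0 < r₀ y} := (measure_congr (Filter.eventuallyEq_univ.2 hpos)).symm
      _ ≤ μ (⋃ y ∈ u, closedBall y (8 * r₀ y)) := by
        refine measure_mono fun y hy => ?_
        obtain ⟨b, hb, hsub⟩ := hcov y hy
        have hy0 : 0 < r₀ y := hy
        refine mem_biUnion hb ?_
        convert hsub (mem_closedBall_self (by positivity)) using 2
        ring
      _ ≤ ∑' y : u, μ (closedBall (y : Y) (8 * r₀ y)) := measure_biUnion_le μ hcount _
      _ ≤ ∑' y : u, ENNReal.ofReal (8 ^ k) * μ (closedBall (y : Y) (r₀ y)) := by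
        refine ENNReal.tsum_le_tsum fun y => ?_
        have hy0 : 0 < r₀ y := hut y.2
        simp only [hr₀] at hy0 ⊢
        exact measure_closedBall_mul_sSup_densityRadii_le hF hk hy0 (by norm_num)
      _ = _ := ENNReal.tsum_mul_left
  have hlt : ENNReal.ofReal (2 * 8 ^ k)⁻¹ * μ univ < ∑' y : u, μ (closedBall (y : Y) (r₀ y)) := by
    have hhalf : ENNReal.ofReal (2 * 8 ^ k)⁻¹ * μ univ < ENNReal.ofReal (8 ^ k)⁻¹ * μ univ := by
      refine (ENNReal.mul_lt_mul_iff_left h0 (measure_ne_top μ _)).2 ?_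
      refine (ENNReal.ofReal_lt_ofReal_iff (by positivity)).2 ?_
      exact inv_strictAnti₀ (by positivity) (lt_mul_of_one_lt_left (by positivity) one_lt_two)
    refine hhalf.trans_le ((mul_le_mul_right htotal _).trans_eq ?_)
    rw [← mul_assoc, ← ENNReal.ofReal_mul (by positivity), inv_mul_cancel₀ (by positivity),
      ENNReal.ofReal_one, one_mul]
  rw [ENNReal.tsum_eq_iSup_sum, lt_iSup_iff] at hlt
  obtain ⟨s, hs⟩ := hlt
  refine ⟨s.card, fun i => ((s.equivFin.symm i : u) : Y), fun i => hut (s.equivFin.symm i : u).2,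
    fun i j hij => hdisj (Subtype.coe_prop _) (Subtype.coe_prop _) fun h =>
      hij (s.equivFin.symm.injective (Subtype.ext (Subtype.ext h))), hs.le.trans_eq ?_⟩
  rw [← Finset.sum_coe_sort]
  exact (s.equivFin.symm.sum_comp fun y : s => μ (closedBall ((y : u) : Y) (r₀ (y : u)))).symm
end

section
/- Fix a real constant C̄ > 0, an integer k ≥ 2, and real numbers 0 ≤ r₀ < r₁ < ∞. Suppose β : [r₀, r₁] → (0,∞) is non-decreasing, satisfies β(r₀) = r₀^k / (C̄^{k-1}·k^k), and for almost every r ∈ (r₀, r₁) (with respect to Lebesgue measure) β is differentiable at r with β(r) ≤ C̄·(β'(r))^{k/(k-1)}. Then β(r) ≥ r^k / (C̄^{k-1}·k^k) for all r ∈ [r₀, r₁]. -/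
open MeasureTheory Set

/-- A function that is monotone on `[a, b]`, with derivative at least `m` almost everywhere,
grows at least as fast as the linear function of slope `m`. -/
theorem MonotoneOn.mul_sub_le_sub_of_ae_le_deriv {f : ℝ → ℝ} {a b m : ℝ} (hab : a ≤ b)
    (hf : MonotoneOn f (Icc a b)) (hm : ∀ᵐ x ∂volume.restrict (Ioo a b), m ≤ deriv f x) :
    m * (b - a) ≤ f b - f a := by
  have hfu : MonotoneOn f (uIcc a b) := by rwa [uIcc_of_le hab]
  have hfab : f a ≤ f b := hf (left_mem_Icc.2 hab) (right_mem_Icc.2 hab) hab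
  have hint := hfu.intervalIntegral_deriv_mem_uIcc
  rw [uIcc_of_le (sub_nonneg.2 hfab)] at hint
  calc m * (b - a) = ∫ _ in a..b, m := by
        rw [intervalIntegral.integral_const, smul_eq_mul, mul_comm]
    _ ≤ ∫ x in a..b, deriv f x := by
        refine intervalIntegral.integral_mono_ae_restrict hab intervalIntegrable_const
          hfu.intervalIntegrable_deriv ?_
        rwa [← restrict_Ioo_eq_restrict_Icc]
    _ ≤ f b - f a := hint.2

/-- The differential inequality `y ≤ C * d ^ (p / (p - 1))`, rewritten as a lower bound for the
derivative `d * (1 / p) * y ^ (1 / p - 1)` of the `p`-th root of `y`. -/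
theorem inv_le_mul_rpow_of_le_mul_rpow {C p y d : ℝ} (hC : 0 < C) (hp : 1 < p) (hy : 0 < y)
    (hd : 0 ≤ d) (h : y ≤ C * d ^ (p / (p - 1))) :
    (p * C ^ ((p - 1) / p))⁻¹ ≤ d * p⁻¹ * y ^ (p⁻¹ - 1) := by
  have hp0 : 0 < p := by linarith
  have hp1 : 0 < p - 1 := by linarith
  have key : y ^ ((p - 1) / p) ≤ C ^ ((p - 1) / p) * d := by
    have := Real.rpow_le_rpow hy.le h (div_pos hp1 hp0).le
    rwa [Real.mul_rpow hC.le (Real.rpow_nonneg hd _), ← Real.rpow_mul hd,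
      div_mul_div_cancel₀ hp1.ne', div_self hp0.ne', Real.rpow_one] at this
  have hexp : p⁻¹ - 1 = -((p - 1) / p) := by field_simp; ring
  have hyp : 0 < y ^ ((p - 1) / p) := Real.rpow_pos_of_pos hy _
  have hCp : 0 < C ^ ((p - 1) / p) := Real.rpow_pos_of_pos hC _
  rw [hexp, Real.rpow_neg hy.le, mul_inv, mul_comm d, mul_assoc]
  gcongr
  rw [← div_eq_mul_inv, inv_eq_one_div, div_le_div_iff₀ hCp hyp]
  linarith

/-- Growth lemma (Lemma 3.3 of Wenger): if `β : [r₀, r₁] → (0,∞)` is non-decreasing,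
`β r₀ = r₀^k / (C^(k-1) k^k)`, and for a.e. `r ∈ (r₀, r₁)` the function `β` is
differentiable at `r` with `β r ≤ C (β' r)^(k/(k-1))`, then
`β r ≥ r^k / (C^(k-1) k^k)` for all `r ∈ [r₀, r₁]`. -/
theorem growth_lemma (C : ℝ) (hC : 0 < C) (k : ℕ) (hk : 2 ≤ k)
    (r₀ r₁ : ℝ) (hr₀ : 0 ≤ r₀) (hr : r₀ < r₁)
    (β : ℝ → ℝ)
    (hmono : MonotoneOn β (Icc r₀ r₁))
    (hpos : ∀ r ∈ Icc r₀ r₁, 0 < β r)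
    (hinit : β r₀ = r₀ ^ k / (C ^ (k - 1) * (k : ℝ) ^ k))
    (hdiff : ∀ᵐ r ∂(volume.restrict (Ioo r₀ r₁)),
      DifferentiableAt ℝ β r ∧
        β r ≤ C * (deriv β r) ^ ((k : ℝ) / ((k : ℝ) - 1))) :
    ∀ r ∈ Icc r₀ r₁, r ^ k / (C ^ (k - 1) * (k : ℝ) ^ k) ≤ β r := by
  intro r hrmem
  have hk0 : k ≠ 0 := by lia
  have hk1 : (1 : ℝ) < k := by exact_mod_cast hk
  have hkpos : (0 : ℝ) < k := by linarith
  set m : ℝ := ((k : ℝ) * C ^ (((k : ℝ) - 1) / k))⁻¹ with hm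
  have hm0 : 0 < m := by positivity
  have hdiv (x : ℝ) : x ^ k / (C ^ (k - 1) * (k : ℝ) ^ k) = (m * x) ^ k := by
    have hCk : (C ^ (((k : ℝ) - 1) / k)) ^ k = C ^ (k - 1) := by
      rw [← Real.rpow_mul_natCast hC.le, div_mul_cancel₀ _ hkpos.ne', ← Real.rpow_natCast,
        Nat.cast_pred (by lia)]
    rw [mul_pow, hm, inv_pow, mul_pow, hCk, div_eq_inv_mul, mul_comm (C ^ (k - 1))]
  have hsub : Icc r₀ r ⊆ Icc r₀ r₁ := Icc_subset_Icc_right hrmem.2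
  have hroot : MonotoneOn (fun x ↦ β x ^ (k : ℝ)⁻¹) (Icc r₀ r) := fun x hx y hy hxy ↦
    Real.rpow_le_rpow (hpos x (hsub hx)).le (hmono (hsub hx) (hsub hy) hxy) (by positivity)
  have hderiv : ∀ᵐ x ∂volume.restrict (Ioo r₀ r), m ≤ deriv (fun x ↦ β x ^ (k : ℝ)⁻¹) x := by
    filter_upwards [ae_restrict_of_ae_restrict_of_subset (Ioo_subset_Ioo_right hrmem.2) hdiff,
      ae_restrict_mem measurableSet_Ioo] with x ⟨hβ, hle⟩ hx
    have hx' : x ∈ Icc r₀ r₁ := hsub (Ioo_subset_Icc_self hx)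
    have hd : 0 ≤ deriv β x := by
      rw [← derivWithin_of_mem_nhds (Icc_mem_nhds hx.1 (hx.2.trans_le hrmem.2))]
      exact hmono.derivWithin_nonneg
    rw [(hβ.hasDerivAt.rpow_const (Or.inl (hpos x hx').ne')).deriv]
    exact inv_le_mul_rpow_of_le_mul_rpow hC hk1 (hpos x hx') hd hle
  have hgrowth := hroot.mul_sub_le_sub_of_ae_le_deriv hrmem.1 hderiv
  have hstart : β r₀ ^ (k : ℝ)⁻¹ = m * r₀ := by
    rw [hinit, hdiv, Real.pow_rpow_inv_natCast (by positivity) hk0]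
  have hend : m * r ≤ β r ^ (k : ℝ)⁻¹ := by
    simp only [hstart] at hgrowth
    linarith
  calc r ^ k / (C ^ (k - 1) * (k : ℝ) ^ k) = (m * r) ^ k := hdiv r
    _ ≤ (β r ^ (k : ℝ)⁻¹) ^ k :=
        pow_le_pow_left₀ (mul_nonneg hm0.le (hr₀.trans hrmem.1)) hend k
    _ = β r := Real.rpow_inv_natCast_pow (hpos r hrmem).le hk0
end

section
/- Let k ≥ 2 be an integer, C > 0 and 0 < λ ≤ 1 real numbers, and set F := λ^{k-1} / (C^{k-1}·k^k). Let r₀ > 0 and suppose β : [r₀, (4/3)·r₀] → (0,∞) is non-decreasing with β(r₀) = F·r₀^k and β(r) < F·r^k for all r ∈ (r₀, (4/3)·r₀]. Then the set Ω of those r ∈ (r₀, (4/3)·r₀) at which β is differentiable and C·(β'(r))^{k/(k-1)} < λ·β(r) has positive Lebesgue measure. -/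
open MeasureTheory Set

/-- If `μ * B ≤ C * d ^ (k / (k - 1))`, then the derivative `d * (1 / k) * B ^ (1 / k - 1)` of a
`k`-th root is bounded below by a constant depending only on `μ`, `C` and `k`. -/
lemma rpow_inv_le_deriv_root {k : ℕ} (hk : 2 ≤ k) {C μ B d : ℝ} (hC : 0 < C) (hμ : 0 < μ)
    (hB : 0 < B) (hd : 0 ≤ d) (h : μ * B ≤ C * d ^ ((k : ℝ) / ((k : ℝ) - 1))) :
    (μ ^ (k - 1) / (C ^ (k - 1) * (k : ℝ) ^ k)) ^ (k : ℝ)⁻¹ ≤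
      d * (k : ℝ)⁻¹ * B ^ ((k : ℝ)⁻¹ - 1) := by
  have hk0 : k ≠ 0 := by omega
  have hkpos : (0 : ℝ) < k := by positivity
  have hk1 : ((k - 1 : ℕ) : ℝ) = (k : ℝ) - 1 := by push_cast [show 1 ≤ k by omega]; ring
  have hk2 : (k : ℝ) - 1 ≠ 0 := by
    rw [← hk1]; exact_mod_cast (by omega : k - 1 ≠ 0)
  have hpow : (μ * B) ^ (k - 1) ≤ C ^ (k - 1) * d ^ k := by
    have hroot : (d ^ ((k : ℝ) / ((k : ℝ) - 1))) ^ (k - 1) = d ^ k := by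
      rw [← Real.rpow_natCast, ← Real.rpow_mul hd, hk1, div_mul_cancel₀ _ hk2, Real.rpow_natCast]
    calc (μ * B) ^ (k - 1) ≤ (C * d ^ ((k : ℝ) / ((k : ℝ) - 1))) ^ (k - 1) := by gcongr
      _ = C ^ (k - 1) * d ^ k := by rw [mul_pow, hroot]
  refine le_of_pow_le_pow_left₀ hk0 (by positivity) ?_
  have hBpow : (B ^ ((k : ℝ)⁻¹ - 1)) ^ k = (B ^ (k - 1))⁻¹ := by
    rw [← Real.rpow_natCast, ← Real.rpow_mul hB.le, ← Real.rpow_natCast, ← Real.rpow_neg hB.le, hk1]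
    congr 1
    field_simp
    ring
  rw [Real.rpow_inv_natCast_pow (by positivity) hk0, mul_pow, mul_pow, hBpow, inv_pow,
    ← div_eq_mul_inv, ← div_eq_mul_inv, div_div, div_le_div_iff₀ (by positivity) (by positivity)]
  rw [mul_pow] at hpow
  calc μ ^ (k - 1) * ((k : ℝ) ^ k * B ^ (k - 1))
      = (k : ℝ) ^ k * (μ ^ (k - 1) * B ^ (k - 1)) := by ring
    _ ≤ (k : ℝ) ^ k * (C ^ (k - 1) * d ^ k) := by gcongr
    _ = d ^ k * (C ^ (k - 1) * (k : ℝ) ^ k) := by ring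

/-- The increment of a monotone function is at least the length of the interval times an almost
everywhere lower bound of its derivative. -/
lemma MonotoneOn.mul_sub_le_of_ae_le_deriv {g : ℝ → ℝ} {a b c : ℝ} (hab : a ≤ b)
    (hg : MonotoneOn g (Icc a b)) (h : ∀ᵐ x, x ∈ Ioo a b → c ≤ deriv g x) :
    c * (b - a) ≤ g b - g a := by
  have hg' : MonotoneOn g (uIcc a b) := by rwa [uIcc_of_le hab]
  have hle : ∫ _ in a..b, c ≤ ∫ x in a..b, deriv g x := by
    refine intervalIntegral.integral_mono_ae_restrict hab (by simp) hg'.intervalIntegrable_deriv ?_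
    rw [Filter.EventuallyLE, restrict_Ioo_eq_restrict_Icc.symm, ae_restrict_iff' measurableSet_Ioo]
    exact h
  have hmem := hg'.intervalIntegral_deriv_mem_uIcc
  rw [uIcc_of_le (sub_nonneg.2 (hg (left_mem_Icc.2 hab) (right_mem_Icc.2 hab) hab))] at hmem
  rw [intervalIntegral.integral_const, smul_eq_mul, mul_comm] at hle
  exact hle.trans hmem.2

/-- Existence of good slicing radii (`k ≥ 2` case of the decomposition argument):
with `F := λ^(k-1) / (C^(k-1) k^k)`, if `β` is non-decreasing on `[r₀, (4/3) r₀]` with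
`β r₀ = F r₀^k` and `β r < F r^k` for `r ∈ (r₀, (4/3) r₀]`, then the set of radii
`r ∈ (r₀, (4/3) r₀)` at which `β` is differentiable and `C (β' r)^(k/(k-1)) < λ β r`
has positive Lebesgue measure. -/
theorem good_radii_pos_measure (k : ℕ) (hk : 2 ≤ k) (C lam : ℝ)
    (hC : 0 < C) (hlam₀ : 0 < lam) (hlam₁ : lam ≤ 1)
    (F : ℝ) (hF : F = lam ^ (k - 1) / (C ^ (k - 1) * (k : ℝ) ^ k))
    (r₀ : ℝ) (hr₀ : 0 < r₀)
    (β : ℝ → ℝ)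
    (hmono : MonotoneOn β (Icc r₀ ((4 / 3) * r₀)))
    (hpos : ∀ r ∈ Icc r₀ ((4 / 3) * r₀), 0 < β r)
    (hinit : β r₀ = F * r₀ ^ k)
    (hlt : ∀ r ∈ Ioc r₀ ((4 / 3) * r₀), β r < F * r ^ k) :
    0 < volume {r : ℝ | r ∈ Ioo r₀ ((4 / 3) * r₀) ∧ DifferentiableAt ℝ β r ∧
      C * (deriv β r) ^ ((k : ℝ) / ((k : ℝ) - 1)) < lam * β r} := by
  by_contra hnull
  rw [not_lt, nonpos_iff_eq_zero] at hnull
  have hab : r₀ < 4 / 3 * r₀ := by linarith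
  have hk0 : k ≠ 0 := by omega
  have hFpos : 0 < F := by rw [hF]; positivity
  have hroot : MonotoneOn (fun r => β r ^ (k : ℝ)⁻¹) (Icc r₀ (4 / 3 * r₀)) := fun x hx y hy hxy =>
    Real.rpow_le_rpow (hpos x hx).le (hmono hx hy hxy) (by positivity)
  have hderiv : ∀ᵐ r, r ∈ Ioo r₀ (4 / 3 * r₀) →
      F ^ (k : ℝ)⁻¹ ≤ deriv (fun r => β r ^ (k : ℝ)⁻¹) r := by
    filter_upwards [hmono.ae_differentiableWithinAt_of_mem, measure_eq_zero_iff_ae_notMem.1 hnull]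
      with r hdiff hbad hr
    have hnhds : Icc r₀ (4 / 3 * r₀) ∈ nhds r := Icc_mem_nhds hr.1 hr.2
    have hr' := Ioo_subset_Icc_self hr
    have hβ : DifferentiableAt ℝ β r := (hdiff hr').differentiableAt hnhds
    have hle : lam * β r ≤ C * deriv β r ^ ((k : ℝ) / ((k : ℝ) - 1)) :=
      not_lt.1 fun hlt' => hbad ⟨hr, hβ, hlt'⟩
    have hd : 0 ≤ deriv β r := by
      rw [← derivWithin_of_mem_nhds hnhds]
      exact hmono.derivWithin_nonneg
    rw [(hβ.hasDerivAt.rpow_const (Or.inl (hpos r hr').ne')).deriv, hF]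
    exact rpow_inv_le_deriv_root hk hC hlam₀ (hpos r hr') hd hle
  have hgrow := hroot.mul_sub_le_of_ae_le_deriv hab.le hderiv
  have hb := hlt _ (right_mem_Ioc.2 hab)
  have hmul : ∀ r : ℝ, 0 ≤ r → (F * r ^ k) ^ (k : ℝ)⁻¹ = F ^ (k : ℝ)⁻¹ * r := fun r hr => by
    rw [Real.mul_rpow hFpos.le (by positivity), Real.pow_rpow_inv_natCast hr hk0]
  have hroot_lt := Real.rpow_lt_rpow (hpos _ (right_mem_Icc.2 hab.le)).le hb
    (show (0 : ℝ) < (k : ℝ)⁻¹ by positivity)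
  rw [hmul _ (by positivity)] at hroot_lt
  simp only [hinit, hmul r₀ hr₀.le] at hgrow
  linarith
end

section
/- Let E be a real normed vector space, let A, B ⊆ E be nonempty bounded convex subsets, and let 0 ≤ s ≤ t ≤ 1. Then the Hausdorff distance between the Minkowski combinations satisfies d_H((1−s)·A + s·B, (1−t)·A + t·B) ≤ (t − s) · d_H(A, B). -/
open Metric Pointwise

/-- Moving the weight `q` from `A` to `B` in a Minkowski combination moves each point by at most
`q * ε` if every point of `A` is `ε`-close to a point of the convex set `B`. -/
theorem exists_dist_le_of_mem_smul_add_smul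
    {E : Type*} [SeminormedAddCommGroup E] [NormedSpace ℝ E] {A B : Set E}
    (hB : Convex ℝ B) {p q r ε : ℝ} (hq : 0 ≤ q) (hr : 0 ≤ r)
    (h : ∀ a ∈ A, ∃ b ∈ B, dist a b ≤ ε) {x : E} (hx : x ∈ (p + q) • A + r • B) :
    ∃ y ∈ p • A + (q + r) • B, dist x y ≤ q * ε := by
  obtain ⟨_, ⟨a, ha, rfl⟩, _, ⟨b, hb, rfl⟩, rfl⟩ := hx
  obtain ⟨b', hb', hab⟩ := h a ha
  refine ⟨p • a + (q • b' + r • b), Set.add_mem_add (Set.smul_mem_smul_set ha) ?_, ?_⟩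
  · rw [hB.add_smul hq hr]
    exact Set.add_mem_add (Set.smul_mem_smul_set hb') (Set.smul_mem_smul_set hb)
  · calc dist ((p + q) • a + r • b) (p • a + (q • b' + r • b))
        = dist (q • a) (q • b') := by
          rw [dist_eq_norm, dist_eq_norm]
          congr 1
          module
      _ = q * dist a b' := by rw [dist_smul₀, Real.norm_of_nonneg hq]
      _ ≤ q * ε := by gcongr

/-- The path `c_{AB}(t) = (1-t)A + tB` on bounded closed convex subsets of a normed space
is Lipschitz with constant `d_H(A,B)`: for nonempty bounded convex `A, B ⊆ E` and
`0 ≤ s ≤ t ≤ 1`, `d_H((1-s)A + sB, (1-t)A + tB) ≤ (t - s) · d_H(A, B)`. -/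
theorem hausdorffDist_combination_lipschitz
    (E : Type*) [NormedAddCommGroup E] [NormedSpace ℝ E]
    (A B : Set E) (hA : A.Nonempty) (hB : B.Nonempty)
    (hAb : Bornology.IsBounded A) (hBb : Bornology.IsBounded B)
    (hAc : Convex ℝ A) (hBc : Convex ℝ B)
    (s t : ℝ) (hs : 0 ≤ s) (hst : s ≤ t) (ht : t ≤ 1) :
    hausdorffDist ((1 - s) • A + s • B) ((1 - t) • A + t • B) ≤
      (t - s) * hausdorffDist A B := by
  have fin := hausdorffEDist_ne_top_of_nonempty_of_bounded hA hB hAb hBb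
  have hq : 0 ≤ t - s := sub_nonneg.2 hst
  have ht' : 0 ≤ 1 - t := sub_nonneg.2 ht
  refine le_of_forall_pos_le_add fun ε hε => ?_
  have hlt : hausdorffDist A B < hausdorffDist A B + ε := lt_add_of_pos_right _ hε
  have hε' : 0 ≤ hausdorffDist A B + ε := add_nonneg hausdorffDist_nonneg hε.le
  have hs' : 1 - s = (1 - t) + (t - s) := by ring
  have key : hausdorffDist ((1 - s) • A + s • B) ((1 - t) • A + t • B) ≤
      (t - s) * (hausdorffDist A B + ε) := by
    refine hausdorffDist_le_of_mem_dist (mul_nonneg hq hε') (fun x hx => ?_) fun x hx => ?_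
    · rw [hs'] at hx
      simpa only [sub_add_cancel] using
        exists_dist_le_of_mem_smul_add_smul hBc hq hs (fun a ha =>
          (exists_dist_lt_of_hausdorffDist_lt ha hlt fin).imp fun _ hb => ⟨hb.1, hb.2.le⟩) hx
    · have hx' : x ∈ (s + (t - s)) • B + (1 - t) • A := by
        rwa [add_sub_cancel, add_comm]
      rw [hs', add_comm, add_comm (1 - t)]
      exact exists_dist_le_of_mem_smul_add_smul hAc hq ht' (fun b hb =>
        (exists_dist_lt_of_hausdorffDist_lt' hb hlt fin).imp fun a ha =>
          ⟨ha.1, (dist_comm b a).trans_le ha.2.le⟩) hx'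
  nlinarith [mul_nonneg (show 0 ≤ 1 - (t - s) by linarith) hε.le]
end
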